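/- arXiv:2510.18376 — 2 statements merged into one kernel-verified Lean document; each statement's English description precedes it below -/
import Mathlib

section
/- There exist constants C>0 and ε₀∈(0,1) such that for all ν∈(0,1], all k with 10ν≤|k|<1, all λ∈ℝ, all ε∈[0,ε₀], every continuous F:I→ℂ, and every solution w_{Na} of the Navier-slip Orr–Sommerfeld problem with data F, the coefficients c₁, c₂ satisfy (1+|λ−1|)|c₁| + (1+|λ+1|)|c₂| ≤ Cν^{−1/6}|k|^{−5/6}‖F‖_{L²(I)}. -/
open MeasureTheory Set

noncomputable section

/-- `L²` norm on `I = [-1,1]`. -/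
def L2I (f : ℝ → ℂ) : ℝ := Real.sqrt (∫ y in (-1:ℝ)..1, ‖f y‖ ^ 2)

/-- The Navier-slip Orr–Sommerfeld problem on `I = [-1,1]` with data `F`:
`−ν(w″−k²w)+ik(y−λ)w−εν^{1/3}|k|^{2/3}w = F` on `I`, `w(±1)=0`. -/
def NavierSlipOS (ν k lam ε : ℝ) (w F : ℝ → ℂ) : Prop :=
  ContDiff ℝ 2 w ∧ w (-1) = 0 ∧ w 1 = 0 ∧
  ∀ y ∈ Icc (-1:ℝ) 1,
    -(ν : ℂ) * (deriv (deriv w) y - (k : ℂ) ^ 2 * w y)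
      + Complex.I * (k : ℂ) * ((y : ℂ) - (lam : ℂ)) * w y
      - ((ε * ν ^ ((1:ℝ)/3) * |k| ^ ((2:ℝ)/3) : ℝ) : ℂ) * w y = F y

/-- Cauchy–Schwarz for pairs of continuous functions on `[-1,1]`. -/
lemma sq_integral_add_mul_le {a b c d : ℝ → ℝ} (ha : Continuous a) (hb : Continuous b)
    (hc : Continuous c) (hd : Continuous d) :
    (∫ y in (-1:ℝ)..1, a y * c y + b y * d y) ^ 2 ≤
      (∫ y in (-1:ℝ)..1, a y ^ 2 + b y ^ 2) * ∫ y in (-1:ℝ)..1, c y ^ 2 + d y ^ 2 := by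
  have key : ∀ t : ℝ, 0 ≤ (∫ y in (-1:ℝ)..1, c y ^ 2 + d y ^ 2) * (t * t)
      + (-2 * ∫ y in (-1:ℝ)..1, a y * c y + b y * d y) * t
      + ∫ y in (-1:ℝ)..1, a y ^ 2 + b y ^ 2 := by
    intro t
    have h : 0 ≤ ∫ y in (-1:ℝ)..1, ((a y - t * c y) ^ 2 + (b y - t * d y) ^ 2) :=
      intervalIntegral.integral_nonneg (by norm_num) fun y _ => by positivity
    have e : ∀ y, (a y - t * c y) ^ 2 + (b y - t * d y) ^ 2 =
        (t * t) * (c y ^ 2 + d y ^ 2) + (-2 * t) * (a y * c y + b y * d y)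
          + (a y ^ 2 + b y ^ 2) := fun y => by ring
    simp_rw [e] at h
    rw [intervalIntegral.integral_add, intervalIntegral.integral_add,
      intervalIntegral.integral_const_mul, intervalIntegral.integral_const_mul] at h
    · linarith
    all_goals exact Continuous.intervalIntegrable (by fun_prop) _ _
  have := discrim_le_zero key
  rw [discrim] at this
  linarith

lemma abs_integral_add_mul_le {a b c d : ℝ → ℝ} (ha : Continuous a) (hb : Continuous b)
    (hc : Continuous c) (hd : Continuous d) :
    |∫ y in (-1:ℝ)..1, a y * c y + b y * d y| ≤
      √(∫ y in (-1:ℝ)..1, a y ^ 2 + b y ^ 2) * √(∫ y in (-1:ℝ)..1, c y ^ 2 + d y ^ 2) := by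
  rw [← Real.sqrt_mul (intervalIntegral.integral_nonneg (by norm_num) fun y _ => by positivity)]
  exact Real.abs_le_sqrt (sq_integral_add_mul_le ha hb hc hd)

/-- The algebraic closure of the energy inequalities. -/
lemma closure_of_energy_inequalities {M a b d ε : ℝ} (hM : 0 ≤ M) (ha : 0 ≤ a) (hb : 0 ≤ b)
    (hε : ε ≤ 1 / 100) (h1 : d ^ 2 ≤ M * b + ε * b ^ 2)
    (h2 : a ^ 2 ≤ M * a + d * b) (h3 : b ^ 2 ≤ 2 * a * d) : b ≤ 100 * M ∧ a ≤ 40 * M := by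
  have h1' : d ^ 2 ≤ M * b + 1 / 100 * b ^ 2 := by nlinarith [sq_nonneg b]
  have hbM : b ≤ 100 * M := by
    by_contra! hlt
    have hb0 : 0 < b := by linarith
    have hd1 : d ≤ 15 / 100 * b := by
      refine le_of_abs_le (abs_le_of_sq_le_sq ?_ (by positivity))
      nlinarith
    have hba : b ≤ 30 / 100 * a := by
      have : b * b ≤ (30 / 100 * a) * b := by nlinarith [mul_le_mul_of_nonneg_left hd1 ha]
      exact le_of_mul_le_mul_right this hb0
    have ha0 : 0 < a := by linarith
    have hdb : d * b ≤ 15 / 100 * (30 / 100 * a) * (30 / 100 * a) := by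
      have : d ≤ 15 / 100 * (30 / 100 * a) := by linarith
      exact mul_le_mul this hba hb (by positivity)
    have : a * (98 / 100 * a) ≤ a * M := by nlinarith
    have := le_of_mul_le_mul_left this ha0
    linarith
  refine ⟨hbM, ?_⟩
  have hd1 : d ≤ 15 * M := by
    refine le_of_abs_le (abs_le_of_sq_le_sq ?_ (by positivity))
    nlinarith
  have hdb : d * b ≤ 15 * M * (100 * M) := mul_le_mul hd1 hbM hb (by positivity)
  by_contra! hlt
  nlinarith

lemma integral_eq_zero_of_hasDerivAt {f f' : ℝ → ℝ} (hf : ∀ y, HasDerivAt f (f' y) y)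
    (hc : Continuous f') (h0 : f (-1) = 0) (h1 : f 1 = 0) : ∫ y in (-1:ℝ)..1, f' y = 0 := by
  rw [intervalIntegral.integral_eq_sub_of_hasDerivAt (fun y _ => hf y)
    (hc.intervalIntegrable _ _), h0, h1, sub_zero]

/-- The weighted `L²` resolvent estimate, for the real and imaginary parts `u`, `v` of a solution,
in the critical-layer scale `δ`. -/
lemma weighted_estimate {u v u' v' u'' v'' g h : ℝ → ℝ} {k δ lam ε : ℝ}
    (hu : ∀ y, HasDerivAt u (u' y) y) (hv : ∀ y, HasDerivAt v (v' y) y)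
    (hu' : ∀ y, HasDerivAt u' (u'' y) y) (hv' : ∀ y, HasDerivAt v' (v'' y) y)
    (cu'' : Continuous u'') (cv'' : Continuous v'')
    (cg : Continuous g) (ch : Continuous h)
    (hu0 : u (-1) = 0) (hu1 : u 1 = 0) (hv0 : v (-1) = 0) (hv1 : v 1 = 0)
    (hk : k ≠ 0) (hδ : 0 < δ) (hε : ε ≤ 1 / 100)
    (hg : ∀ y, g y = -(|k| * δ ^ 3) * (u'' y - k ^ 2 * u y) - k * (y - lam) * v y
      - ε * |k| * δ * u y)
    (hh : ∀ y, h y = -(|k| * δ ^ 3) * (v'' y - k ^ 2 * v y) + k * (y - lam) * u y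
      - ε * |k| * δ * v y) :
    δ * √(∫ y in (-1:ℝ)..1, u y ^ 2 + v y ^ 2)
        ≤ 100 * (√(∫ y in (-1:ℝ)..1, g y ^ 2 + h y ^ 2) / |k|) ∧
      √(∫ y in (-1:ℝ)..1, ((y - lam) * u y) ^ 2 + ((y - lam) * v y) ^ 2)
        ≤ 40 * (√(∫ y in (-1:ℝ)..1, g y ^ 2 + h y ^ 2) / |k|) := by
  have cu : Continuous u := continuous_iff_continuousAt.2 fun y => (hu y).continuousAt
  have cv : Continuous v := continuous_iff_continuousAt.2 fun y => (hv y).continuousAt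
  have cu' : Continuous u' := continuous_iff_continuousAt.2 fun y => (hu' y).continuousAt
  have cv' : Continuous v' := continuous_iff_continuousAt.2 fun y => (hv' y).continuousAt
  have hκ : 0 < |k| := abs_pos.2 hk
  have nonneg : ∀ a b : ℝ → ℝ, 0 ≤ ∫ y in (-1:ℝ)..1, a y ^ 2 + b y ^ 2 := fun a b =>
    intervalIntegral.integral_nonneg (by norm_num) fun y _ => by positivity
  have hA := Real.sq_sqrt (nonneg (fun y => (y - lam) * u y) (fun y => (y - lam) * v y))
  have hB := Real.sq_sqrt (nonneg u v)
  have hD := Real.sq_sqrt (nonneg u' v')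
  have x1 := abs_integral_add_mul_le cg ch cu cv
  have x2 := abs_integral_add_mul_le ch cg.neg (c := fun y => (y - lam) * u y)
    (d := fun y => (y - lam) * v y) (by fun_prop) (by fun_prop)
  have x3 := abs_integral_add_mul_le cv' cu'.neg cu cv
  have x4 := abs_integral_add_mul_le cu' cv' (c := fun y => (y - lam) * u y)
    (d := fun y => (y - lam) * v y) (by fun_prop) (by fun_prop)
  have e1 : (∫ y in (-1:ℝ)..1, g y * u y + h y * v y)
      = |k| * δ ^ 3 * (∫ y in (-1:ℝ)..1, u' y ^ 2 + v' y ^ 2)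
        + (|k| * δ ^ 3 * k ^ 2 - ε * |k| * δ) * ∫ y in (-1:ℝ)..1, u y ^ 2 + v y ^ 2 := by
    have z := integral_eq_zero_of_hasDerivAt
      (f := fun y => -(|k| * δ ^ 3) * (u' y * u y + v' y * v y))
      (fun y => (((hu' y).mul (hu y)).add ((hv' y).mul (hv y))).const_mul (-(|k| * δ ^ 3)))
      (by fun_prop) (by simp [hu0, hv0]) (by simp [hu1, hv1])
    rw [← intervalIntegral.integral_const_mul, ← intervalIntegral.integral_const_mul,
      ← intervalIntegral.integral_add, ← sub_eq_zero, ← intervalIntegral.integral_sub, ← z]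
    · congr 1; ext y; rw [hg, hh]; ring
    all_goals exact Continuous.intervalIntegrable (by fun_prop) _ _
  have e2 : (∫ y in (-1:ℝ)..1, h y * ((y - lam) * u y) + -g y * ((y - lam) * v y))
      = k * (∫ y in (-1:ℝ)..1, ((y - lam) * u y) ^ 2 + ((y - lam) * v y) ^ 2)
        + |k| * δ ^ 3 * ∫ y in (-1:ℝ)..1, v' y * u y + -u' y * v y := by
    have z := integral_eq_zero_of_hasDerivAt
      (f := fun y => -(|k| * δ ^ 3) * ((y - lam) * (v' y * u y - u' y * v y)))
      (fun y => ((((hasDerivAt_id y).sub_const lam).mul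
        (((hv' y).mul (hu y)).sub ((hu' y).mul (hv y))))).const_mul (-(|k| * δ ^ 3)))
      (by simp only [id, Pi.mul_apply, Pi.sub_apply]; fun_prop)
      (by simp [hu0, hv0]) (by simp [hu1, hv1])
    rw [← intervalIntegral.integral_const_mul, ← intervalIntegral.integral_const_mul,
      ← intervalIntegral.integral_add, ← sub_eq_zero, ← intervalIntegral.integral_sub, ← z]
    · congr 1; ext y; simp only [id, Pi.mul_apply, Pi.sub_apply]; rw [hg, hh]; ring
    all_goals exact Continuous.intervalIntegrable (by fun_prop) _ _
  have e3 : (∫ y in (-1:ℝ)..1, u y ^ 2 + v y ^ 2)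
      = -2 * ∫ y in (-1:ℝ)..1, u' y * ((y - lam) * u y) + v' y * ((y - lam) * v y) := by
    have z := integral_eq_zero_of_hasDerivAt
      (f := fun y => (y - lam) * (u y * u y + v y * v y))
      (fun y => ((hasDerivAt_id y).sub_const lam).mul
        (((hu y).mul (hu y)).add ((hv y).mul (hv y))))
      (by simp only [id]; fun_prop)
      (by simp [hu0, hv0]) (by simp [hu1, hv1])
    rw [← intervalIntegral.integral_const_mul, ← sub_eq_zero,
      ← intervalIntegral.integral_sub, ← z]
    · congr 1; ext y; simp only [id]; ring
    all_goals exact Continuous.intervalIntegrable (by fun_prop) _ _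
  have x3s : √(∫ y in (-1:ℝ)..1, v' y ^ 2 + (-u' y) ^ 2)
      = √(∫ y in (-1:ℝ)..1, u' y ^ 2 + v' y ^ 2) := by
    congr 2; ext y; ring
  have x2s : √(∫ y in (-1:ℝ)..1, h y ^ 2 + (-g y) ^ 2)
      = √(∫ y in (-1:ℝ)..1, g y ^ 2 + h y ^ 2) := by
    congr 2; ext y; ring
  simp only [Pi.neg_apply] at x2 x3
  rw [x3s] at x3
  rw [x2s] at x2
  rw [← hB, ← hD] at e1
  rw [← hA] at e2
  rw [← hB] at e3
  have hN0 := Real.sqrt_nonneg (∫ y in (-1:ℝ)..1, g y ^ 2 + h y ^ 2)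
  have hA0 := Real.sqrt_nonneg
    (∫ y in (-1:ℝ)..1, ((y - lam) * u y) ^ 2 + ((y - lam) * v y) ^ 2)
  have hB0 := Real.sqrt_nonneg (∫ y in (-1:ℝ)..1, u y ^ 2 + v y ^ 2)
  have hD0 := Real.sqrt_nonneg (∫ y in (-1:ℝ)..1, u' y ^ 2 + v' y ^ 2)
  clear hA hB hD
  generalize √(∫ y in (-1:ℝ)..1, g y ^ 2 + h y ^ 2) = N at *
  generalize √(∫ y in (-1:ℝ)..1, ((y - lam) * u y) ^ 2 + ((y - lam) * v y) ^ 2) = A at *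
  generalize √(∫ y in (-1:ℝ)..1, u y ^ 2 + v y ^ 2) = B at *
  generalize √(∫ y in (-1:ℝ)..1, u' y ^ 2 + v' y ^ 2) = D at *
  rw [e1] at x1
  rw [e2] at x2
  generalize (∫ y in (-1:ℝ)..1, v' y * u y + -u' y * v y) = X3 at *
  generalize (∫ y in (-1:ℝ)..1, u' y * ((y - lam) * u y) + v' y * ((y - lam) * v y)) = X4 at *
  refine closure_of_energy_inequalities (d := δ ^ 2 * D) (ε := ε) (by positivity) hA0
    (by positivity) hε ?_ ?_ ?_
  · have h1 := (abs_le.1 x1).2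
    have h2 : 0 ≤ |k| * δ ^ 3 * k ^ 2 * B ^ 2 := by positivity
    have h3 : |k| * δ ^ 3 * D ^ 2 ≤ N * B + ε * |k| * δ * B ^ 2 := by linarith
    have h4 := mul_le_mul_of_nonneg_left h3 (by positivity : 0 ≤ δ / |k|)
    calc (δ ^ 2 * D) ^ 2 = δ / |k| * (|k| * δ ^ 3 * D ^ 2) := by field_simp
      _ ≤ _ := h4
      _ = _ := by field_simp
  · have h1 : |k * A ^ 2| ≤ N * A + |k| * δ ^ 3 * (D * B) := by
      calc |k * A ^ 2| = |(k * A ^ 2 + |k| * δ ^ 3 * X3) - |k| * δ ^ 3 * X3| := by ring_nf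
        _ ≤ |k * A ^ 2 + |k| * δ ^ 3 * X3| + |(|k| * δ ^ 3 * X3)| := abs_sub _ _
        _ ≤ _ := by
          rw [abs_mul (|k| * δ ^ 3), abs_of_pos (by positivity : 0 < |k| * δ ^ 3)]
          gcongr
    rw [abs_mul, abs_of_nonneg (sq_nonneg A)] at h1
    have h4 := mul_le_mul_of_nonneg_left h1 (by positivity : 0 ≤ 1 / |k|)
    calc A ^ 2 = 1 / |k| * (|k| * A ^ 2) := by field_simp
      _ ≤ _ := h4
      _ = _ := by field_simp
  · have h1 := (abs_le.1 x4).1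
    have h3 : B ^ 2 ≤ 2 * A * D := by linarith
    have h4 := mul_le_mul_of_nonneg_left h3 (by positivity : 0 ≤ δ ^ 2)
    linarith

lemma integral_inv_sq_add_sq_le (lam : ℝ) {δ : ℝ} (hδ : 0 < δ) :
    ∫ y in (-1:ℝ)..1, ((y - lam) ^ 2 + δ ^ 2)⁻¹ ≤ Real.pi / δ := by
  have hd : ∀ y : ℝ, HasDerivAt (fun y => Real.arctan ((y - lam) / δ) / δ)
      ((y - lam) ^ 2 + δ ^ 2)⁻¹ y := by
    intro y
    refine ((((hasDerivAt_id' y).sub_const lam).div_const δ).arctan.div_const δ).congr_deriv ?_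
    have : (y - lam) ^ 2 + δ ^ 2 ≠ 0 := by positivity
    have : 1 + ((y - lam) / δ) ^ 2 ≠ 0 := by positivity
    field_simp
    ring
  rw [intervalIntegral.integral_eq_sub_of_hasDerivAt (fun y _ => hd y)
    (Continuous.intervalIntegrable (Continuous.inv₀ (by fun_prop) fun y => by positivity) _ _),
    ← sub_div]
  gcongr
  linarith [Real.arctan_lt_pi_div_two ((1 - lam) / δ),
    Real.neg_pi_div_two_lt_arctan ((-1 - lam) / δ)]

/-- Weighted `L²` bounds control the `L¹` norm, with decay in the spectral parameter. -/
lemma weight_mul_integral_norm_le {w : ℝ → ℂ} (cw : Continuous w) {δ lam M : ℝ} (hδ : 0 < δ)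
    (hδ1 : δ ≤ 1) (hB : δ * √(∫ y in (-1:ℝ)..1, ‖w y‖ ^ 2) ≤ 100 * M)
    (hA : √(∫ y in (-1:ℝ)..1, ((y - lam) * ‖w y‖) ^ 2) ≤ 40 * M) :
    (2 + |lam|) * ∫ y in (-1:ℝ)..1, ‖w y‖ ≤ 1000 * (M / √δ) := by
  have hsδ : 0 < √δ := Real.sqrt_pos.2 hδ
  have hM : 0 ≤ M := by linarith [Real.sqrt_nonneg (∫ y in (-1:ℝ)..1, ((y - lam) * ‖w y‖) ^ 2)]
  have hA2 : ∫ y in (-1:ℝ)..1, ((y - lam) * ‖w y‖) ^ 2 ≤ (40 * M) ^ 2 :=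
    (Real.sqrt_le_left (by positivity)).1 hA
  have hB2 : δ ^ 2 * ∫ y in (-1:ℝ)..1, ‖w y‖ ^ 2 ≤ (100 * M) ^ 2 := by
    have h0 : 0 ≤ ∫ y in (-1:ℝ)..1, ‖w y‖ ^ 2 :=
      intervalIntegral.integral_nonneg (by norm_num) fun y _ => by positivity
    rw [← Real.sq_sqrt h0, ← mul_pow]
    exact pow_le_pow_left₀ (by positivity) hB 2
  rcases le_total |lam| 3 with hl | hl
  · have hL : ∫ y in (-1:ℝ)..1, ‖w y‖ ≤ 200 * (M / √δ) := by
      have hρ : ∀ y : ℝ, 0 < √((y - lam) ^ 2 + δ ^ 2) := fun y => by positivity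
      have cs := sq_integral_add_mul_le (a := fun y => √((y - lam) ^ 2 + δ ^ 2) * ‖w y‖)
        (b := fun _ => 0) (c := fun y => (√((y - lam) ^ 2 + δ ^ 2))⁻¹) (d := fun _ => 0)
        (by fun_prop) continuous_const
        (Continuous.inv₀ (by fun_prop) fun y => (hρ y).ne') continuous_const
      have r1 : ∀ y : ℝ, √((y - lam) ^ 2 + δ ^ 2) * ‖w y‖ * (√((y - lam) ^ 2 + δ ^ 2))⁻¹
          + 0 * 0 = ‖w y‖ := fun y => by
        have := (hρ y).ne'
        field_simp
        simp
      have r2 : ∀ y : ℝ, (√((y - lam) ^ 2 + δ ^ 2) * ‖w y‖) ^ 2 + 0 ^ 2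
          = ((y - lam) * ‖w y‖) ^ 2 + δ ^ 2 * ‖w y‖ ^ 2 := fun y => by
        rw [mul_pow, Real.sq_sqrt (by positivity)]; ring
      have r3 : ∀ y : ℝ, ((√((y - lam) ^ 2 + δ ^ 2))⁻¹) ^ 2 + 0 ^ 2
          = ((y - lam) ^ 2 + δ ^ 2)⁻¹ := fun y => by
        rw [inv_pow, Real.sq_sqrt (by positivity)]; ring
      simp_rw [r1, r2, r3] at cs
      rw [intervalIntegral.integral_add
        (Continuous.intervalIntegrable (by fun_prop) _ _)
        (Continuous.intervalIntegrable (by fun_prop) _ _),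
        intervalIntegral.integral_const_mul] at cs
      refine le_of_abs_le (abs_le_of_sq_le_sq ?_ (by positivity))
      calc (∫ y in (-1:ℝ)..1, ‖w y‖) ^ 2 ≤ _ := cs
        _ ≤ ((40 * M) ^ 2 + (100 * M) ^ 2) * (Real.pi / δ) := by
          gcongr
          · exact intervalIntegral.integral_nonneg (by norm_num) fun y _ => by positivity
          · exact integral_inv_sq_add_sq_le lam hδ
        _ ≤ ((40 * M) ^ 2 + (100 * M) ^ 2) * (3.15 / δ) := by
          gcongr
          exact Real.pi_lt_d2.le
        _ ≤ (200 * (M / √δ)) ^ 2 := by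
          rw [mul_pow 200, div_pow, Real.sq_sqrt hδ.le, ← mul_div_assoc, ← mul_div_assoc]
          refine div_le_div_of_nonneg_right ?_ hδ.le
          nlinarith [sq_nonneg M]
    have h0 : 0 ≤ ∫ y in (-1:ℝ)..1, ‖w y‖ :=
      intervalIntegral.integral_nonneg (by norm_num) fun y _ => norm_nonneg _
    nlinarith
  · have cs := sq_integral_add_mul_le (a := fun y => |y - lam| * ‖w y‖)
      (b := fun _ => 0) (c := fun _ => 1) (d := fun _ => 0)
      (by fun_prop) continuous_const continuous_const continuous_const
    have r2 : ∀ y : ℝ, (|y - lam| * ‖w y‖) ^ 2 + 0 ^ 2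
          = ((y - lam) * ‖w y‖) ^ 2 := fun y => by rw [mul_pow, sq_abs]; ring
    simp_rw [r2] at cs
    norm_num at cs
    have h1 : ∫ y in (-1:ℝ)..1, |y - lam| * ‖w y‖ ≤ 80 * M := by
      refine le_of_abs_le (abs_le_of_sq_le_sq ?_ (by positivity))
      nlinarith [sq_nonneg M]
    have h2 : (2 + |lam|) * ∫ y in (-1:ℝ)..1, ‖w y‖
        ≤ 5 / 2 * ∫ y in (-1:ℝ)..1, |y - lam| * ‖w y‖ := by
      rw [← intervalIntegral.integral_const_mul, ← intervalIntegral.integral_const_mul]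
      apply intervalIntegral.integral_mono_on (by norm_num)
        (Continuous.intervalIntegrable (by fun_prop) _ _)
        (Continuous.intervalIntegrable (by fun_prop) _ _)
      intro y hy
      have hy1 : |y| ≤ 1 := abs_le.2 hy
      have hy2 : |lam| - |y| ≤ |y - lam| := by
        rw [abs_sub_comm]; exact abs_sub_abs_le_abs_sub _ _
      rw [← mul_assoc]
      gcongr
      linarith
    have h3 : M ≤ M / √δ := by
      rw [le_div_iff₀ hsδ]
      exact mul_le_of_le_one_right hM (Real.sqrt_le_one.2 hδ1)
    linarith

lemma abs_sinh_div_sinh_le_one {a b : ℝ} (h : |a| ≤ |b|) : |Real.sinh a / Real.sinh b| ≤ 1 := by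
  rw [abs_div, Real.abs_sinh, Real.abs_sinh]
  exact div_le_one_of_le₀ (Real.sinh_le_sinh.2 h) (Real.sinh_nonneg_iff.2 (abs_nonneg b))

lemma norm_integral_ofReal_mul_le {m : ℝ → ℝ} {w : ℝ → ℂ} (cw : Continuous w)
    (hm : ∀ y ∈ Icc (-1:ℝ) 1, |m y| ≤ 1) :
    ‖∫ y in (-1:ℝ)..1, (m y : ℂ) * w y‖ ≤ ∫ y in (-1:ℝ)..1, ‖w y‖ := by
  apply intervalIntegral.norm_integral_le_of_norm_le (by norm_num) _
    (cw.norm.intervalIntegrable _ _)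
  refine Filter.Eventually.of_forall fun y hy => ?_
  rw [norm_mul, Complex.norm_real, Real.norm_eq_abs]
  exact mul_le_of_le_one_left (norm_nonneg _) (hm y (Ioc_subset_Icc_self hy))

/-- The `L¹` form of the resolvent estimate for the Navier-slip problem. -/
lemma NavierSlipOS.weight_mul_integral_norm_le {ν k lam ε : ℝ} {w F : ℝ → ℂ} (hν : 0 < ν)
    (hk : ν ≤ |k|) (hε : ε ≤ 1 / 100) (hw : NavierSlipOS ν k lam ε w F) :
    (2 + |lam|) * ∫ y in (-1:ℝ)..1, ‖w y‖
      ≤ 1000 * (ν ^ (-(1:ℝ)/6) * |k| ^ (-(5:ℝ)/6) * L2I F) := by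
  obtain ⟨hw2, hw0, hw1, heq⟩ := hw
  have hκ : 0 < |k| := hν.trans_le hk
  have hk0 : k ≠ 0 := abs_pos.1 hκ
  set δ : ℝ := (ν / |k|) ^ ((1:ℝ)/3) with hδdef
  have hδ : 0 < δ := by positivity
  have hδ1 : δ ≤ 1 := Real.rpow_le_one (by positivity) ((div_le_one hκ).2 hk) (by norm_num)
  have hδ3 : |k| * δ ^ 3 = ν := by
    rw [hδdef, ← Real.rpow_natCast, ← Real.rpow_mul (by positivity)]
    norm_num
    field_simp
  have hδε : ε * ν ^ ((1:ℝ)/3) * |k| ^ ((2:ℝ)/3) = ε * |k| * δ := by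
    have : |k| ^ ((2:ℝ)/3) = |k| / |k| ^ ((1:ℝ)/3) := by
      rw [show (2:ℝ)/3 = 1 - 1/3 by norm_num, Real.rpow_sub hκ, Real.rpow_one]
    rw [hδdef, Real.div_rpow hν.le hκ.le, this]
    ring
  have hscale : L2I F / |k| / √δ = ν ^ (-(1:ℝ)/6) * |k| ^ (-(5:ℝ)/6) * L2I F := by
    have h1 : √δ = ν ^ ((1:ℝ)/6) / |k| ^ ((1:ℝ)/6) := by
      rw [Real.sqrt_eq_rpow, hδdef, ← Real.rpow_mul (by positivity),
        Real.div_rpow hν.le hκ.le]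
      norm_num
    have h2 : ν ^ (-(1:ℝ)/6) = (ν ^ ((1:ℝ)/6))⁻¹ := by
      rw [← Real.rpow_neg hν.le]; norm_num
    have h3 : |k| ^ (-(5:ℝ)/6) = |k| ^ ((1:ℝ)/6) / |k| := by
      rw [show -(5:ℝ)/6 = 1/6 - 1 by norm_num, Real.rpow_sub hκ, Real.rpow_one]
    rw [h1, h2, h3]
    have := Real.rpow_pos_of_pos hν ((1:ℝ)/6)
    have := Real.rpow_pos_of_pos hκ ((1:ℝ)/6)
    field_simp
  have cw : Continuous w := hw2.continuous
  have hw2' : ContDiff ℝ (1 + 1) w := hw2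
  have hd1 : ContDiff ℝ 1 (deriv w) := ((contDiff_succ_iff_deriv).1 hw2').2.2
  have dw : ∀ y, HasDerivAt w (deriv w y) y := fun y =>
    (hw2.differentiable (by norm_num) y).hasDerivAt
  have dw' : ∀ y, HasDerivAt (deriv w) (deriv (deriv w) y) y := fun y =>
    (hd1.differentiable (by norm_num) y).hasDerivAt
  have cw'' : Continuous (deriv (deriv w)) := hd1.continuous_deriv (by norm_num)
  have hre : ∀ {f : ℝ → ℂ} {f' : ℂ} {y : ℝ}, HasDerivAt f f' y →
      HasDerivAt (fun y => (f y).re) f'.re y := fun h =>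
    Complex.reCLM.hasFDerivAt.comp_hasDerivAt _ h
  have him : ∀ {f : ℝ → ℂ} {f' : ℂ} {y : ℝ}, HasDerivAt f f' y →
      HasDerivAt (fun y => (f y).im) f'.im y := fun h =>
    Complex.imCLM.hasFDerivAt.comp_hasDerivAt _ h
  set G : ℝ → ℂ := fun y => -(ν : ℂ) * (deriv (deriv w) y - (k : ℂ) ^ 2 * w y)
      + Complex.I * (k : ℂ) * ((y : ℂ) - (lam : ℂ)) * w y
      - ((ε * ν ^ ((1:ℝ)/3) * |k| ^ ((2:ℝ)/3) : ℝ) : ℂ) * w y with hG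
  have cG : Continuous G := by fun_prop
  have hsq : ∀ z : ℂ, z.re ^ 2 + z.im ^ 2 = ‖z‖ ^ 2 := fun z => by
    rw [Complex.sq_norm, Complex.normSq_apply]; ring
  have hF : √(∫ y in (-1:ℝ)..1, (G y).re ^ 2 + (G y).im ^ 2) = L2I F := by
    rw [L2I]
    congr 1
    apply intervalIntegral.integral_congr
    intro y hy
    rw [uIcc_of_le (by norm_num)] at hy
    simp only [hsq]
    rw [← heq y hy]
  have est := weighted_estimate (k := k) (δ := δ) (lam := lam) (ε := ε)
    (fun y => hre (dw y)) (fun y => him (dw y)) (fun y => hre (dw' y)) (fun y => him (dw' y))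
    (by fun_prop) (by fun_prop) (g := fun y => (G y).re) (h := fun y => (G y).im)
    (by fun_prop) (by fun_prop) (by simp [hw0]) (by simp [hw1]) (by simp [hw0]) (by simp [hw1])
    hk0 hδ hε
    (fun y => by
      rw [hδ3, ← hδε, hG]
      simp only [← Complex.ofReal_pow, ← Complex.ofReal_sub, ← Complex.ofReal_neg,
        Complex.add_re, Complex.sub_re, Complex.mul_re, Complex.mul_im, Complex.sub_im,
        Complex.ofReal_re, Complex.ofReal_im, Complex.I_re, Complex.I_im]
      ring)
    (fun y => by
      rw [hδ3, ← hδε, hG]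
      simp only [← Complex.ofReal_pow, ← Complex.ofReal_sub, ← Complex.ofReal_neg,
        Complex.add_im, Complex.sub_re, Complex.mul_re, Complex.mul_im, Complex.sub_im,
        Complex.ofReal_re, Complex.ofReal_im, Complex.I_re, Complex.I_im]
      ring)
  simp only [mul_pow, ← mul_add, hsq] at est
  simp only [hsq] at hF
  rw [hF] at est
  rw [← hscale]
  exact _root_.weight_mul_integral_norm_le cw hδ hδ1 est.1 (by simpa only [mul_pow] using est.2)

/-- bounds on the boundary coefficients `c₁, c₂`, `F ∈ L²`. -/
theorem stmt_8 :
    ∃ C > 0, ∃ ε₀ ∈ Ioo (0:ℝ) 1, ∀ ν ∈ Ioc (0:ℝ) 1, ∀ k : ℝ,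
      10 * ν ≤ |k| → |k| < 1 → ∀ lam : ℝ, ∀ ε ∈ Icc (0:ℝ) ε₀,
      ∀ F : ℝ → ℂ, ContinuousOn F (Icc (-1:ℝ) 1) →
      ∀ wNa : ℝ → ℂ, NavierSlipOS ν k lam ε wNa F →
      (1 + |lam - 1|) *
          ‖∫ y in (-1:ℝ)..1,
              ((Real.sinh (k * (y + 1)) / Real.sinh (2 * k) : ℝ) : ℂ) * wNa y‖
        + (1 + |lam + 1|) *
          ‖∫ y in (-1:ℝ)..1,
              ((Real.sinh (k * (1 - y)) / Real.sinh (2 * k) : ℝ) : ℂ) * wNa y‖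
      ≤ C * ν ^ (-(1:ℝ)/6) * |k| ^ (-(5:ℝ)/6) * L2I F := by
  refine ⟨2000, by norm_num, 1 / 100, by norm_num, ?_⟩
  rintro ν ⟨hν, -⟩ k hk - lam ε ⟨-, hε⟩ F - w hw
  have hL := hw.weight_mul_integral_norm_le hν (by linarith) hε
  have cw : Continuous w := hw.1.continuous
  have hle : ∀ {a : ℝ}, |a| ≤ 2 → |k * a| ≤ |2 * k| := fun ha => by
    rw [abs_mul, abs_mul, abs_two, mul_comm]
    gcongr
  have h1 := norm_integral_ofReal_mul_le (m := fun y => Real.sinh (k * (y + 1)) / Real.sinh (2 * k))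
    cw fun y hy => abs_sinh_div_sinh_le_one
      (hle (abs_le.2 ⟨by linarith [hy.1], by linarith [hy.2]⟩))
  have h2 := norm_integral_ofReal_mul_le (m := fun y => Real.sinh (k * (1 - y)) / Real.sinh (2 * k))
    cw fun y hy => abs_sinh_div_sinh_le_one
      (hle (abs_le.2 ⟨by linarith [hy.2], by linarith [hy.1]⟩))
  have hw1 : 1 + |lam - 1| ≤ 2 + |lam| := by
    have := abs_sub lam 1
    rw [abs_one] at this
    linarith
  have hw2 : 1 + |lam + 1| ≤ 2 + |lam| := by
    have := abs_add_le lam 1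
    rw [abs_one] at this
    linarith
  have m1 := mul_le_mul hw1 h1 (norm_nonneg _) (by positivity)
  have m2 := mul_le_mul hw2 h2 (norm_nonneg _) (by positivity)
  linarith
end
end

section
/- There exists a constant C>0 such that for every k∈ℝ with |k|≤1 and every ψ∈C²(I,ℂ) with ψ(1)=ψ(−1)=0, setting w=ψ″−k²ψ, the following hold: (i) ‖ψ″‖²_{L²(I)}+2k²‖ψ′‖²_{L²(I)}+k⁴‖ψ‖²_{L²(I)}=‖w‖²_{L²(I)}; (ii) ‖ψ′‖²_{L²(I)}+‖ψ‖²_{L²(I)}≤C‖w‖²_{L¹(I)}; (iii) ‖ψ′‖_{L^∞(I)}+‖ψ‖_{L^∞(I)}≤C‖w‖_{L¹(I)}; and (iv) ‖ψ′‖_{L^∞(I)}≤C‖ψ′‖^{1/2}_{L²(I)}‖w‖^{1/2}_{L²(I)}. -/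
open MeasureTheory Set

noncomputable section

/-- `L¹` norm on `I = [-1,1]`. -/
def L1I (f : ℝ → ℂ) : ℝ := ∫ y in (-1:ℝ)..1, ‖f y‖

/-- `L^∞` norm on `I = [-1,1]`. -/
def LinfI (f : ℝ → ℂ) : ℝ := ⨆ y : Icc (-1:ℝ) 1, ‖f (y : ℝ)‖

/-- Cauchy–Schwarz for integrals of continuous functions on an interval. -/
theorem sq_intervalIntegral_mul_le {a b : ℝ} (hab : a ≤ b) {f g : ℝ → ℝ}
    (hf : Continuous f) (hg : Continuous g) :
    (∫ y in a..b, f y * g y) ^ 2 ≤ (∫ y in a..b, f y ^ 2) * ∫ y in a..b, g y ^ 2 := by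
  have h : ∀ t : ℝ, 0 ≤ (∫ y in a..b, g y ^ 2) * (t * t) +
      (2 * ∫ y in a..b, f y * g y) * t + ∫ y in a..b, f y ^ 2 := by
    intro t
    have h0 : 0 ≤ ∫ y in a..b, (g y ^ 2 * (t * t) + f y * g y * (2 * t) + f y ^ 2) := by
      refine intervalIntegral.integral_nonneg hab fun y _ => ?_
      nlinarith [sq_nonneg (g y * t + f y)]
    rw [intervalIntegral.integral_add (Continuous.intervalIntegrable (by fun_prop) _ _)
      (Continuous.intervalIntegrable (by fun_prop) _ _),
      intervalIntegral.integral_add (Continuous.intervalIntegrable (by fun_prop) _ _)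
      (Continuous.intervalIntegrable (by fun_prop) _ _),
      intervalIntegral.integral_mul_const, intervalIntegral.integral_mul_const] at h0
    linarith
  have := discrim_le_zero h
  unfold discrim at this
  nlinarith

/-- The oscillation of a `C¹` function on `[-1,1]` is at most the `L¹` norm of its derivative. -/
theorem norm_sub_le_integral_norm_deriv {E : Type*} [NormedAddCommGroup E] [NormedSpace ℝ E]
    [CompleteSpace E] {f f' : ℝ → E} (hf : ∀ x, HasDerivAt f (f' x) x) (hf' : Continuous f')
    {x y : ℝ} (hx : x ∈ Icc (-1 : ℝ) 1) (hy : y ∈ Icc (-1 : ℝ) 1) :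
    ‖f x - f y‖ ≤ ∫ t in (-1 : ℝ)..1, ‖f' t‖ := by
  rw [← intervalIntegral.integral_eq_sub_of_hasDerivAt (fun t _ => hf t)
    (hf'.intervalIntegrable y x)]
  refine (intervalIntegral.norm_integral_le_integral_norm_uIoc).trans ?_
  rw [intervalIntegral.integral_of_le (by norm_num)]
  refine setIntegral_mono_set ?_ (Filter.Eventually.of_forall fun t => norm_nonneg _) ?_
  · exact (hf'.norm.intervalIntegrable (-1) 1).1
  · exact (Ioc_subset_Ioc (le_min hy.1 hx.1) (max_le hy.2 hx.2)).eventuallyLE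

theorem L2I_nonneg (f : ℝ → ℂ) : 0 ≤ L2I f := Real.sqrt_nonneg _

theorem L2I_sq (f : ℝ → ℂ) : L2I f ^ 2 = ∫ y in (-1:ℝ)..1, ‖f y‖ ^ 2 :=
  Real.sq_sqrt (intervalIntegral.integral_nonneg (by norm_num) fun _ _ => by positivity)

theorem L1I_nonneg (f : ℝ → ℂ) : 0 ≤ L1I f :=
  intervalIntegral.integral_nonneg (by norm_num) fun _ _ => norm_nonneg _

theorem LinfI_le {f : ℝ → ℂ} {M : ℝ} (h : ∀ x ∈ Icc (-1 : ℝ) 1, ‖f x‖ ≤ M) : LinfI f ≤ M := by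
  have : Nonempty (Icc (-1 : ℝ) 1) := ⟨⟨0, by norm_num⟩⟩
  exact ciSup_le fun y => h y y.2

theorem integral_norm_mul_norm_le {f g : ℝ → ℂ} (hf : Continuous f) (hg : Continuous g) :
    ∫ y in (-1:ℝ)..1, ‖f y‖ * ‖g y‖ ≤ L2I f * L2I g := by
  refine abs_le_of_sq_le_sq' ?_ (mul_nonneg (L2I_nonneg f) (L2I_nonneg g)) |>.2
  rw [mul_pow, L2I_sq, L2I_sq]
  exact sq_intervalIntegral_mul_le (by norm_num) hf.norm hg.norm

theorem L1I_sq_le {f : ℝ → ℂ} (hf : Continuous f) : L1I f ^ 2 ≤ 2 * L2I f ^ 2 := by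
  have h := sq_intervalIntegral_mul_le (a := -1) (b := 1) (by norm_num) hf.norm
    (continuous_const (y := (1 : ℝ)))
  simp only [mul_one, one_pow, intervalIntegral.integral_const, smul_eq_mul] at h
  rw [L2I_sq]
  unfold L1I
  linarith

theorem L2I_sq_le {f : ℝ → ℂ} (hf : Continuous f) {M : ℝ}
    (h : ∀ x ∈ Icc (-1 : ℝ) 1, ‖f x‖ ^ 2 ≤ M) : L2I f ^ 2 ≤ 2 * M := by
  rw [L2I_sq]
  have := intervalIntegral.integral_mono_on (μ := volume) (a := -1) (b := 1) (by norm_num)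
    (Continuous.intervalIntegrable (by fun_prop) _ _) (continuous_const.intervalIntegrable _ _) h
  simp only [intervalIntegral.integral_const, smul_eq_mul] at this
  linarith

/-- Integration by parts for a function vanishing at `±1`. -/
theorem integral_inner_deriv_deriv {u u₁ u₂ : ℝ → ℂ} (hu : ∀ x, HasDerivAt u (u₁ x) x)
    (hu₁ : ∀ x, HasDerivAt u₁ (u₂ x) x) (hc : Continuous u₂) (h1 : u 1 = 0) (h2 : u (-1) = 0) :
    ∫ y in (-1:ℝ)..1, inner ℝ (u y) (u₂ y) = -L2I u₁ ^ 2 := by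
  have c0 : Continuous u := continuous_iff_continuousAt.2 fun x => (hu x).continuousAt
  have c1 : Continuous u₁ := continuous_iff_continuousAt.2 fun x => (hu₁ x).continuousAt
  have h := intervalIntegral.integral_eq_sub_of_hasDerivAt (a := -1) (b := 1)
    (fun t _ => (hu t).inner ℝ (hu₁ t))
    (Continuous.intervalIntegrable (by fun_prop) _ _)
  rw [intervalIntegral.integral_add (Continuous.intervalIntegrable (by fun_prop) _ _)
      (Continuous.intervalIntegrable (by fun_prop) _ _)] at h
  simp only [h1, h2, inner_zero_left, real_inner_self_eq_norm_sq, sub_self] at h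
  rw [L2I_sq]
  linarith

/-- Pointwise Poincaré inequality on `[-1,1]`. -/
theorem norm_sq_le_of_vanishing {u u₁ : ℝ → ℂ} (hu : ∀ x, HasDerivAt u (u₁ x) x)
    (hc : Continuous u₁) (h2 : u (-1) = 0) {x : ℝ} (hx : x ∈ Icc (-1 : ℝ) 1) :
    ‖u x‖ ^ 2 ≤ 2 * L2I u₁ ^ 2 := by
  have h := norm_sub_le_integral_norm_deriv hu hc hx (y := -1) (by norm_num)
  rw [h2, sub_zero] at h
  exact (pow_le_pow_left₀ (norm_nonneg _) h 2).trans (L1I_sq_le hc)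

/-- The derivative of a function with equal end values has mean zero, hence is bounded by the
`L¹` norm of the second derivative. -/
theorem norm_deriv_le_L1I {u u₁ u₂ : ℝ → ℂ} (hu : ∀ x, HasDerivAt u (u₁ x) x)
    (hu₁ : ∀ x, HasDerivAt u₁ (u₂ x) x) (hc : Continuous u₂) (h : u 1 = u (-1))
    {x : ℝ} (hx : x ∈ Icc (-1 : ℝ) 1) : ‖u₁ x‖ ≤ L1I u₂ := by
  have c1 : Continuous u₁ := continuous_iff_continuousAt.2 fun x => (hu₁ x).continuousAt
  have hI := intervalIntegral.integral_eq_sub_of_hasDerivAt (a := -1) (b := 1)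
    (fun t _ => hu t) (c1.intervalIntegrable _ _)
  have hb : ‖∫ y in (-1:ℝ)..1, (u₁ x - u₁ y)‖ ≤ L1I u₂ * |1 - (-1)| := by
    refine intervalIntegral.norm_integral_le_of_norm_le_const fun y hy => ?_
    rw [uIoc_of_le (by norm_num)] at hy
    exact norm_sub_le_integral_norm_deriv hu₁ hc hx ⟨hy.1.le, hy.2⟩
  rw [intervalIntegral.integral_sub (continuous_const.intervalIntegrable _ _)
    (c1.intervalIntegrable _ _), hI, h, sub_self, sub_zero,
    intervalIntegral.integral_const, norm_smul] at hb
  norm_num at hb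
  linarith

/-- Agmon-type interpolation inequality on `[-1,1]`. -/
theorem norm_sq_le_interpolation {f f' : ℝ → ℂ} (hf : ∀ x, HasDerivAt f (f' x) x)
    (hc : Continuous f') {x : ℝ} (hx : x ∈ Icc (-1 : ℝ) 1) :
    2 * ‖f x‖ ^ 2 ≤ L2I f ^ 2 + 4 * (L2I f * L2I f') := by
  have c1 : Continuous f := continuous_iff_continuousAt.2 fun x => (hf x).continuousAt
  have hK : ∫ t in (-1:ℝ)..1, ‖2 * inner ℝ (f t) (f' t)‖ ≤ 2 * (L2I f * L2I f') := by
    refine le_trans ?_ (mul_le_mul_of_nonneg_left (integral_norm_mul_norm_le c1 hc) two_pos.le)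
    rw [← intervalIntegral.integral_const_mul]
    refine intervalIntegral.integral_mono (by norm_num)
      (Continuous.intervalIntegrable (by fun_prop) _ _)
      (Continuous.intervalIntegrable (by fun_prop) _ _) fun t => ?_
    simp only [norm_mul, Real.norm_ofNat]
    exact mul_le_mul_of_nonneg_left (norm_inner_le_norm _ _) two_pos.le
  have hy : ∀ y ∈ Icc (-1 : ℝ) 1, ‖f x‖ ^ 2 ≤ ‖f y‖ ^ 2 + 2 * (L2I f * L2I f') := by
    intro y hy
    have := norm_sub_le_integral_norm_deriv (fun t => (hf t).norm_sq)
      (by fun_prop) hx hy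
    have := (le_abs_self _).trans (this.trans hK)
    linarith
  have := intervalIntegral.integral_mono_on (μ := volume) (a := -1) (b := 1) (by norm_num)
    (continuous_const.intervalIntegrable _ _)
    (Continuous.intervalIntegrable (by fun_prop) _ _) hy
  rw [intervalIntegral.integral_add (Continuous.intervalIntegrable (by fun_prop) _ _)
    (continuous_const.intervalIntegrable _ _), ← L2I_sq f] at this
  simp only [intervalIntegral.integral_const, smul_eq_mul] at this
  linarith

/-- basic elliptic estimates for `ψ″ − k²ψ = w` with `ψ(±1) = 0`. -/
theorem stmt_18 :
    ∃ C > 0, ∀ k : ℝ, |k| ≤ 1 → ∀ ψ : ℝ → ℂ, ContDiff ℝ 2 ψ →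
      ψ 1 = 0 → ψ (-1) = 0 →
      (L2I (deriv (deriv ψ)) ^ 2 + 2 * k ^ 2 * L2I (deriv ψ) ^ 2 + k ^ 4 * L2I ψ ^ 2
          = L2I (fun y => deriv (deriv ψ) y - (k : ℂ) ^ 2 * ψ y) ^ 2) ∧
      (L2I (deriv ψ) ^ 2 + L2I ψ ^ 2
          ≤ C * L1I (fun y => deriv (deriv ψ) y - (k : ℂ) ^ 2 * ψ y) ^ 2) ∧
      (LinfI (deriv ψ) + LinfI ψ
          ≤ C * L1I (fun y => deriv (deriv ψ) y - (k : ℂ) ^ 2 * ψ y)) ∧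
      (LinfI (deriv ψ)
          ≤ C * L2I (deriv ψ) ^ ((1:ℝ)/2)
              * L2I (fun y => deriv (deriv ψ) y - (k : ℂ) ^ 2 * ψ y) ^ ((1:ℝ)/2)) := by
  refine ⟨10, by norm_num, fun k hk ψ hψ h1 h2 => ?_⟩
  have hk2 : k ^ 2 ≤ 1 := by rw [← sq_abs]; exact pow_le_one₀ (abs_nonneg k) hk
  have hψ' : ContDiff ℝ 1 (deriv ψ) := hψ.deriv' (n := 1)
  have hc : Continuous (deriv (deriv ψ)) := hψ'.continuous_deriv le_rfl
  have c0 : Continuous ψ := hψ.continuous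
  have c1 : Continuous (deriv ψ) := hψ'.continuous
  have d0 : ∀ x, HasDerivAt ψ (deriv ψ x) x := fun x =>
    (hψ.differentiable (by norm_num) x).hasDerivAt
  have d1 : ∀ x, HasDerivAt (deriv ψ) (deriv (deriv ψ) x) x := fun x =>
    (hψ'.differentiable (by norm_num) x).hasDerivAt
  set w : ℝ → ℂ := fun y => deriv (deriv ψ) y - (k : ℂ) ^ 2 * ψ y with hw
  have cw : Continuous w := by fun_prop
  have hsm : ∀ y, w y = deriv (deriv ψ) y - (k ^ 2) • ψ y := fun y => by
    simp [hw, Complex.real_smul]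
  have hparts := integral_inner_deriv_deriv d0 d1 hc h1 h2
  have hpoinc := fun x hx => norm_sq_le_of_vanishing d0 c1 h2 (x := x) hx
  have hB := L2I_sq_le c0 hpoinc
  have nA := L2I_nonneg (deriv ψ)
  have nB := L2I_nonneg ψ
  have nD := L2I_nonneg (deriv (deriv ψ))
  have nw := L2I_nonneg w
  have nW := L1I_nonneg w
  have e1 : L2I (deriv (deriv ψ)) ^ 2 + 2 * k ^ 2 * L2I (deriv ψ) ^ 2 + k ^ 4 * L2I ψ ^ 2
      = L2I w ^ 2 := by
    have : ∀ y, ‖w y‖ ^ 2 = ‖deriv (deriv ψ) y‖ ^ 2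
        - 2 * k ^ 2 * inner ℝ (ψ y) (deriv (deriv ψ) y) + k ^ 4 * ‖ψ y‖ ^ 2 := fun y => by
      rw [hsm, norm_sub_sq_real, real_inner_smul_right, norm_smul, mul_pow,
        real_inner_comm, Real.norm_eq_abs, sq_abs]
      ring
    rw [L2I_sq w]
    simp only [this]
    rw [intervalIntegral.integral_add (Continuous.intervalIntegrable (by fun_prop) _ _)
      (Continuous.intervalIntegrable (by fun_prop) _ _),
      intervalIntegral.integral_sub (Continuous.intervalIntegrable (by fun_prop) _ _)
      (Continuous.intervalIntegrable (by fun_prop) _ _),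
      intervalIntegral.integral_const_mul, intervalIntegral.integral_const_mul, hparts,
      ← L2I_sq, ← L2I_sq]
    ring
  have hsup : ∀ x ∈ Icc (-1 : ℝ) 1, ‖ψ x‖ ≤ √2 * L2I (deriv ψ) := fun x hx => by
    refine abs_le_of_sq_le_sq' ?_ (by positivity) |>.2
    rw [mul_pow, Real.sq_sqrt two_pos.le]
    exact hpoinc x hx
  have hA : L2I (deriv ψ) ≤ √2 * L1I w := by
    have hle : L2I (deriv ψ) ^ 2 ≤ √2 * L2I (deriv ψ) * L1I w := by
      have hpt : ∀ y ∈ Icc (-1 : ℝ) 1, -inner ℝ (ψ y) (deriv (deriv ψ) y)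
          ≤ √2 * L2I (deriv ψ) * ‖w y‖ := fun y hy => by
        have hin : inner ℝ (ψ y) (w y)
            = inner ℝ (ψ y) (deriv (deriv ψ) y) - k ^ 2 * ‖ψ y‖ ^ 2 := by
          rw [hsm, inner_sub_right, real_inner_smul_right, real_inner_self_eq_norm_sq]
        have hcs := (neg_le_abs _).trans (abs_real_inner_le_norm (ψ y) (w y))
        have := mul_le_mul_of_nonneg_right (hsup y hy) (norm_nonneg (w y))
        have : 0 ≤ k ^ 2 * ‖ψ y‖ ^ 2 := by positivity
        linarith
      have := intervalIntegral.integral_mono_on (μ := volume) (a := -1) (b := 1) (by norm_num)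
        (Continuous.intervalIntegrable (by fun_prop) _ _)
        (Continuous.intervalIntegrable (by fun_prop) _ _) hpt
      rw [intervalIntegral.integral_neg, intervalIntegral.integral_const_mul, hparts,
        neg_neg] at this
      exact this
    rcases nA.eq_or_lt with h | h
    · rw [← h]; positivity
    · refine le_of_mul_le_mul_left ?_ h
      linarith
  have hs2 : √2 * √2 = 2 := Real.mul_self_sqrt two_pos.le
  have hA2 : L2I (deriv ψ) ^ 2 ≤ 2 * L1I w ^ 2 := by
    have := pow_le_pow_left₀ nA hA 2
    rwa [mul_pow, Real.sq_sqrt two_pos.le] at this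
  have hsupW : ∀ x ∈ Icc (-1 : ℝ) 1, ‖ψ x‖ ≤ 2 * L1I w := fun x hx => by
    have := mul_le_mul_of_nonneg_left hA (Real.sqrt_nonneg 2)
    rw [← mul_assoc, hs2] at this
    exact (hsup x hx).trans this
  refine ⟨e1, by linarith, ?_, ?_⟩
  · have hD : L1I (deriv (deriv ψ)) ≤ 5 * L1I w := by
      have hpt : ∀ y ∈ Icc (-1 : ℝ) 1, ‖deriv (deriv ψ) y‖ ≤ ‖w y‖ + 2 * L1I w := fun y hy => by
        have : deriv (deriv ψ) y = w y + (k ^ 2) • ψ y := by rw [hsm]; abel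
        rw [this]
        refine (norm_add_le _ _).trans (add_le_add le_rfl ?_)
        rw [norm_smul, Real.norm_of_nonneg (sq_nonneg k)]
        exact (mul_le_of_le_one_left (norm_nonneg _) hk2).trans (hsupW y hy)
      have := intervalIntegral.integral_mono_on (μ := volume) (a := -1) (b := 1) (by norm_num)
        (Continuous.intervalIntegrable (by fun_prop) _ _)
        (Continuous.intervalIntegrable (by fun_prop) _ _) hpt
      rw [intervalIntegral.integral_add (Continuous.intervalIntegrable (by fun_prop) _ _)
        (continuous_const.intervalIntegrable _ _)] at this
      simp only [intervalIntegral.integral_const, smul_eq_mul] at this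
      unfold L1I at *
      linarith
    have := LinfI_le fun x hx =>
      (norm_deriv_le_L1I d0 d1 hc (h1.trans h2.symm) (x := x) hx).trans hD
    have := LinfI_le hsupW
    linarith
  · have hDw : L2I (deriv (deriv ψ)) ≤ L2I w := by
      refine abs_le_of_sq_le_sq' ?_ nw |>.2
      have : 0 ≤ 2 * k ^ 2 * L2I (deriv ψ) ^ 2 + k ^ 4 * L2I ψ ^ 2 := by positivity
      linarith
    have hB' : L2I ψ ≤ 2 * L2I (deriv ψ) :=
      abs_le_of_sq_le_sq' (by linarith) (by positivity) |>.2
    have hAD : L2I (deriv ψ) ^ 2 ≤ L2I ψ * L2I (deriv (deriv ψ)) := by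
      rw [← neg_neg (L2I (deriv ψ) ^ 2), ← hparts, ← intervalIntegral.integral_neg]
      refine le_trans ?_ (integral_norm_mul_norm_le c0 hc)
      refine intervalIntegral.integral_mono (by norm_num)
        (Continuous.intervalIntegrable (by fun_prop) _ _)
        (Continuous.intervalIntegrable (by fun_prop) _ _) fun t => ?_
      exact (neg_le_abs _).trans (abs_real_inner_le_norm _ _)
    have hAw : L2I (deriv ψ) ^ 2 ≤ 2 * L2I (deriv ψ) * L2I w :=
      hAD.trans (mul_le_mul hB' hDw nD (by positivity))
    have hm := mul_le_mul_of_nonneg_left hDw nA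
    refine LinfI_le fun x hx => ?_
    rw [← Real.sqrt_eq_rpow, ← Real.sqrt_eq_rpow]
    refine abs_le_of_sq_le_sq' ?_ (by positivity) |>.2
    rw [mul_pow, mul_pow, Real.sq_sqrt nA, Real.sq_sqrt nw]
    have := norm_sq_le_interpolation d1 hc hx
    have : 0 ≤ L2I (deriv ψ) * L2I w := by positivity
    linarith
end
end
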